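/- Let R be a commutative noetherian ring, C a semidualizing R-module, M an R-module, and n ≥ 0. The following are equivalent: (i) M has C-flat C-cotorsion projective dimension at most n; (ii) M ≅ C ⊗_R K for some R-module K admitting an exact sequence 0 → F_n → ⋯ → F_0 → K → 0 with each F_i flat and cotorsion; (iii) M has C-flat projective dimension at most n and Ext_R^i(N, M) = 0 for every C-flat R-module N and every i ≥ 1. -/

import Mathlib

open CategoryTheory TensorProduct

universe u

section
variable (R : Type u) [CommRing R]

def extZero (M N : ModuleCat.{u} R) : Prop :=
  ∀ i : ℕ, 1 ≤ i → Subsingleton (((Ext R (ModuleCat.{u} R) i).obj (Opposite.op M)).obj N)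

def torZero (M N : ModuleCat.{u} R) : Prop :=
  ∀ i : ℕ, 1 ≤ i → Subsingleton (((Tor (ModuleCat.{u} R) i).obj M).obj N)

def IsSemidualizing (C : ModuleCat.{u} R) : Prop :=
  Module.Finite R C ∧ Function.Bijective (LinearMap.lsmul R C) ∧ extZero R C C

/-- A module is `C`-flat if it is isomorphic to `F ⊗[R] C` with `F` flat. -/
def IsCFlat (C M : ModuleCat.{u} R) : Prop :=
  ∃ F : ModuleCat.{u} R, Module.Flat R F ∧ Nonempty (M ≃ₗ[R] (F ⊗[R] C))

def IsCInjective (C M : ModuleCat.{u} R) : Prop :=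
  ∃ I : ModuleCat.{u} R, Module.Injective R I ∧ Nonempty (M ≃ₗ[R] (↥C →ₗ[R] ↥I))

/-- cotorsion: `Ext^{≥1}(F, N) = 0` for all flat `F`. -/
def IsCotorsion (N : ModuleCat.{u} R) : Prop :=
  ∀ F : ModuleCat.{u} R, Module.Flat R F → extZero R F N

/-- `C`-cotorsion: `Ext^{≥1}(F ⊗ C, N) = 0` for all flat `F`. -/
def IsCCotorsion (C N : ModuleCat.{u} R) : Prop :=
  ∀ F : ModuleCat.{u} R, Module.Flat R F →
    extZero R (ModuleCat.of R (↥F ⊗[R] ↥C)) N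

/-- `C`-flat `C`-cotorsion: isomorphic to `F ⊗ C` with `F` flat and cotorsion. -/
def IsCFlatCotorsion (C M : ModuleCat.{u} R) : Prop :=
  ∃ F : ModuleCat.{u} R, Module.Flat R F ∧ IsCotorsion R F ∧
    Nonempty (M ≃ₗ[R] (F ⊗[R] C))

/-- The natural evaluation map `C ⊗ Hom(C,M) → M`. -/
noncomputable def evalMap (C M : ModuleCat.{u} R) :
    (↥C ⊗[R] (↥C →ₗ[R] ↥M)) →ₗ[R] ↥M :=
  TensorProduct.lift (LinearMap.id (R := R) (M := ↥C →ₗ[R] ↥M)).flip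

/-- The Bass class `B_C(R)`. -/
noncomputable def InBassClass (C M : ModuleCat.{u} R) : Prop :=
  extZero R C M ∧
  torZero R C (ModuleCat.of R (↥C →ₗ[R] ↥M)) ∧
  Function.Bijective (evalMap R C M)

/-- A `ℤ`-indexed complex of `R`-modules: `d i : X (i+1) → X i`. -/
structure ZComplex where
  X : ℤ → ModuleCat.{u} R
  d : ∀ i : ℤ, ↥(X (i + 1)) →ₗ[R] ↥(X i)
  d_comp_d : ∀ i : ℤ, (d i).comp (d (i + 1)) = 0

namespace ZComplex

variable {R} (Z : ZComplex R)

/-- Exactness of the complex. -/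
def IsExact : Prop := ∀ i : ℤ, Function.Exact (Z.d (i + 1)) (Z.d i)

/-- Exactness of `Z ⊗[R] J`. -/
def TensorExact (J : ModuleCat.{u} R) : Prop :=
  ∀ i : ℤ, Function.Exact (LinearMap.rTensor (↥J) (Z.d (i + 1)))
    (LinearMap.rTensor (↥J) (Z.d i))

/-- Exactness of `Hom_R(V, Z)`. -/
def HomFromExact (V : ModuleCat.{u} R) : Prop :=
  ∀ i : ℤ, Function.Exact
    (fun f : ↥V →ₗ[R] ↥(Z.X (i + 1 + 1)) => (Z.d (i + 1)).comp f)
    (fun f : ↥V →ₗ[R] ↥(Z.X (i + 1)) => (Z.d i).comp f)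

/-- Exactness of `Hom_R(Z, V)`. -/
def HomToExact (V : ModuleCat.{u} R) : Prop :=
  ∀ i : ℤ, Function.Exact
    (fun g : ↥(Z.X i) →ₗ[R] ↥V => g.comp (Z.d i))
    (fun g : ↥(Z.X (i + 1)) →ₗ[R] ↥V => g.comp (Z.d (i + 1)))

/-- `M ≅ Coker(∂₁)`. -/
def IsCokerOfD1 (M : ModuleCat.{u} R) : Prop :=
  Nonempty (↥M ≃ₗ[R] (↥(Z.X 0) ⧸ LinearMap.range (Z.d 0)))

end ZComplex

end

section
variable (R : Type u) [CommRing R]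

/-- A complete `FF_C`-resolution witnessing that `M` is `G_C`-flat. -/
def IsGCFlat (C M : ModuleCat.{u} R) : Prop :=
  ∃ Z : ZComplex R, Z.IsExact ∧
    (∀ i : ℤ, 0 ≤ i → Module.Flat R (Z.X i)) ∧
    (∀ i : ℤ, i < 0 → IsCFlat R C (Z.X i)) ∧
    (∀ J : ModuleCat.{u} R, IsCInjective R C J → Z.TensorExact J) ∧
    Z.IsCokerOfD1 M

def IsCProjective (C M : ModuleCat.{u} R) : Prop :=
  ∃ P : ModuleCat.{u} R, Module.Projective R P ∧ Nonempty (M ≃ₗ[R] (P ⊗[R] C))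

/-- A complete `PP_C`-resolution witnessing that `M` is `G_C`-projective. -/
def IsGCProjective (C M : ModuleCat.{u} R) : Prop :=
  ∃ Z : ZComplex R, Z.IsExact ∧
    (∀ i : ℤ, 0 ≤ i → Module.Projective R (Z.X i)) ∧
    (∀ i : ℤ, i < 0 → IsCProjective R C (Z.X i)) ∧
    (∀ Q : ModuleCat.{u} R, IsCProjective R C Q → Z.HomToExact Q) ∧
    Z.IsCokerOfD1 M

/-- `G(𝒳)` for a class `𝒳` of modules. -/
def GClass (𝒳 : ModuleCat.{u} R → Prop) (M : ModuleCat.{u} R) : Prop :=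
  ∃ Z : ZComplex R, Z.IsExact ∧
    (∀ i : ℤ, 𝒳 (Z.X i)) ∧
    (∀ V : ModuleCat.{u} R, 𝒳 V → Z.HomFromExact V) ∧
    (∀ V : ModuleCat.{u} R, 𝒳 V → Z.HomToExact V) ∧
    Z.IsCokerOfD1 M

/-- Iterates `G^n(𝒳)`, with `G^0(𝒳) = 𝒳`. -/
def GIter : ℕ → (ModuleCat.{u} R → Prop) → (ModuleCat.{u} R → Prop)
  | 0, 𝒳 => 𝒳
  | n + 1, 𝒳 => GClass R (GIter n 𝒳)

/-- `H_C(𝒳)`: modules with a `P_C F_C^cot`-complete `𝒳`-resolution. -/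
def HClass (C : ModuleCat.{u} R) (𝒳 : ModuleCat.{u} R → Prop) (M : ModuleCat.{u} R) : Prop :=
  ∃ Z : ZComplex R, Z.IsExact ∧
    (∀ i : ℤ, 𝒳 (Z.X i)) ∧
    (∀ P : ModuleCat.{u} R, Module.Projective R P →
      Z.HomFromExact (ModuleCat.of R (↥P ⊗[R] ↥C))) ∧
    (∀ N : ModuleCat.{u} R, IsCFlatCotorsion R C N → Z.HomToExact N) ∧
    Z.IsCokerOfD1 M

/-- Iterates `H_C^n(𝒳)`, with `H_C^0(𝒳) = 𝒳`. -/
def HIter (C : ModuleCat.{u} R) : ℕ → (ModuleCat.{u} R → Prop) → (ModuleCat.{u} R → Prop)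
  | 0, 𝒳 => 𝒳
  | n + 1, 𝒳 => HClass R C (HIter C n 𝒳)

/-- `M` admits a resolution `0 → X_n → ⋯ → X_0 → M → 0` with each `X_i` in `𝒳`. -/
def HasResOfLength (𝒳 : ModuleCat.{u} R → Prop) (n : ℕ) (M : ModuleCat.{u} R) : Prop :=
  ∃ (P : ℕ → ModuleCat.{u} R) (d : ∀ i : ℕ, ↥(P (i + 1)) →ₗ[R] ↥(P i))
    (ε : ↥(P 0) →ₗ[R] ↥M),
      Function.Surjective ε ∧ Function.Exact (d 0) ε ∧
      (∀ i : ℕ, Function.Exact (d (i + 1)) (d i)) ∧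
      (∀ i : ℕ, i ≤ n → 𝒳 (P i)) ∧
      (∀ i : ℕ, n < i → Subsingleton (P i))

/-- `M` admits a coresolution `0 → M → Y_0 → ⋯ → Y_n → 0` with each `Y_i` in `𝒳`. -/
def HasCoresOfLength (𝒳 : ModuleCat.{u} R → Prop) (n : ℕ) (M : ModuleCat.{u} R) : Prop :=
  ∃ (P : ℕ → ModuleCat.{u} R) (d : ∀ i : ℕ, ↥(P i) →ₗ[R] ↥(P (i + 1)))
    (η : ↥M →ₗ[R] ↥(P 0)),
      Function.Injective η ∧ Function.Exact η (d 0) ∧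
      (∀ i : ℕ, Function.Exact (d i) (d (i + 1))) ∧
      (∀ i : ℕ, i ≤ n → 𝒳 (P i)) ∧
      (∀ i : ℕ, n < i → Subsingleton (P i))

/-- `C` is a dualizing module: semidualizing of finite injective dimension. -/
def IsDualizing (C : ModuleCat.{u} R) : Prop :=
  IsSemidualizing R C ∧
  ∃ n : ℕ, HasCoresOfLength R (fun I => Module.Injective R ↥I) n C

end

section ShortExact

variable {R : Type u} [CommRing R]

/-- Two composable linear maps forming a short exact sequence. -/
structure IsSES {A B D : Type u} [AddCommGroup A] [AddCommGroup B] [AddCommGroup D]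
    [Module R A] [Module R B] [Module R D] (f : A →ₗ[R] B) (g : B →ₗ[R] D) : Prop where
  inj : Function.Injective f
  exact : Function.Exact f g
  surj : Function.Surjective g

variable {A B D : Type u} [AddCommGroup A] [AddCommGroup B] [AddCommGroup D]
  [Module R A] [Module R B] [Module R D]

lemma IsSES.comp_eq_zero {f : A →ₗ[R] B} {g : B →ₗ[R] D} (h : IsSES f g) : g ∘ₗ f = 0 :=
  h.exact.linearMap_comp_eq_zero

lemma isSES_ker {g : B →ₗ[R] D} (hg : Function.Surjective g) :
    IsSES (LinearMap.ker g).subtype g :=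
  ⟨Subtype.val_injective, LinearMap.exact_subtype_ker_map g, hg⟩

lemma isSES_range {f : A →ₗ[R] B} (hf : Function.Injective f) :
    IsSES f (LinearMap.range f).mkQ :=
  ⟨hf, LinearMap.exact_map_mkQ_range f, Submodule.mkQ_surjective _⟩

/-- The short complex attached to a short exact sequence of linear maps. -/
abbrev IsSES.shortComplex {f : A →ₗ[R] B} {g : B →ₗ[R] D} (h : IsSES f g) :
    ShortComplex (ModuleCat.{u} R) :=
  ShortComplex.mk (ModuleCat.ofHom f) (ModuleCat.ofHom g)
    (by rw [← ModuleCat.ofHom_comp, h.comp_eq_zero]; rfl)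

lemma IsSES.shortExact {f : A →ₗ[R] B} {g : B →ₗ[R] D} (h : IsSES f g) :
    h.shortComplex.ShortExact where
  exact := (ShortComplex.ShortExact.moduleCat_exact_iff_function_exact _).2 h.exact
  mono_f := (ModuleCat.mono_iff_injective _).2 h.inj
  epi_g := (ModuleCat.epi_iff_surjective _).2 h.surj

end ShortExact

section ExtVanish

variable (R : Type u) [CommRing R]

/-- Vanishing of all positive `Ext` modules. -/
def ExtVanish (A X : Type u) [AddCommGroup A] [AddCommGroup X] [Module R A] [Module R X] : Prop :=
  ∀ i : ℕ, Subsingleton (Abelian.Ext (ModuleCat.of R A) (ModuleCat.of R X) (i + 1))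

variable {R}

lemma subsingleton_ext_iff (A X : ModuleCat.{u} R) (i : ℕ) :
    Subsingleton (((Ext R (ModuleCat.{u} R) (i + 1)).obj (Opposite.op A)).obj X) ↔
      Subsingleton (Abelian.Ext A X (i + 1)) := by
  let P := projectiveResolution A
  have key : Subsingleton (Abelian.Ext A X (i + 1)) ↔
      ∀ f : P.complex.X (i + 1) ⟶ X, P.complex.d (i + 2) (i + 1) ≫ f = 0 →
        ∃ g : P.complex.X i ⟶ X, P.complex.d (i + 1) i ≫ g = f := by
    constructor
    · intro h f hf
      exact (P.extMk_eq_zero_iff f (i + 2) rfl hf i rfl).1 (Subsingleton.elim _ _)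
    · intro h
      refine subsingleton_of_forall_eq 0 fun α => ?_
      obtain ⟨f, hf, rfl⟩ := P.extMk_surjective α (i + 2) rfl
      exact (P.extMk_eq_zero_iff f (i + 2) rfl hf i rfl).2 (h f hf)
  rw [key, ← ModuleCat.isZero_iff_subsingleton,
    (P.isoExt (i + 1) X).isZero_iff, ← HomologicalComplex.exactAt_iff_isZero_homology,
    HomologicalComplex.exactAt_iff' _ i (i + 1) (i + 2) (by simp) (by simp),
    ShortComplex.moduleCat_exact_iff]
  rfl

lemma extZero_iff (A X : ModuleCat.{u} R) : extZero R A X ↔ ExtVanish R A X := by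
  refine ⟨fun h i => (subsingleton_ext_iff A X i).1 (h (i + 1) (by omega)), fun h i hi => ?_⟩
  obtain ⟨j, rfl⟩ : ∃ j, i = j + 1 := ⟨i - 1, by omega⟩
  exact (subsingleton_ext_iff A X j).2 (h j)

variable {A B D X : Type u} [AddCommGroup A] [AddCommGroup B] [AddCommGroup D] [AddCommGroup X]
  [Module R A] [Module R B] [Module R D] [Module R X]

lemma ExtVanish.of_equiv_left (e : A ≃ₗ[R] B) (h : ExtVanish R A X) : ExtVanish R B X := by
  intro i
  have := h i
  refine subsingleton_of_forall_eq 0 fun x => ?_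
  have h0 : (Abelian.Ext.mk₀ e.toModuleIso.hom).comp x (zero_add _) = 0 := Subsingleton.elim _ _
  have h1 := congrArg (fun y => (Abelian.Ext.mk₀ e.toModuleIso.inv).comp y (zero_add _)) h0
  simpa only [Abelian.Ext.mk₀_comp_mk₀_assoc, Iso.inv_hom_id, Abelian.Ext.mk₀_id_comp,
    Abelian.Ext.comp_zero] using h1

lemma ExtVanish.of_equiv_right (e : X ≃ₗ[R] B) (h : ExtVanish R A X) : ExtVanish R A B := by
  intro i
  have := h i
  refine subsingleton_of_forall_eq 0 fun x => ?_
  have h0 : x.comp (Abelian.Ext.mk₀ e.toModuleIso.inv) (add_zero _) = 0 := Subsingleton.elim _ _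
  have h1 := congrArg (fun y => y.comp (Abelian.Ext.mk₀ e.toModuleIso.hom) (add_zero _)) h0
  simpa only [Abelian.Ext.comp_assoc_of_third_deg_zero, Abelian.Ext.mk₀_comp_mk₀, Iso.inv_hom_id,
    Abelian.Ext.comp_mk₀_id, Abelian.Ext.zero_comp] using h1

lemma ExtVanish.of_projective [Module.Projective R A] : ExtVanish R A X := by
  intro i
  have : Projective (ModuleCat.of R A) := (IsProjective.iff_projective A).1 inferInstance
  exact subsingleton_of_forall_eq 0 fun x => Abelian.Ext.eq_zero_of_projective x

variable {f : A →ₗ[R] B} {g : B →ₗ[R] D}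

/-- The kernel end of a sequence with `Ext`-acyclic middle and right terms is `Ext`-acyclic. -/
lemma ExtVanish.of_ker (h : IsSES f g) (hB : ExtVanish R B X) (hD : ExtVanish R D X) :
    ExtVanish R A X := by
  intro i
  have := hB i
  have := hD (i + 1)
  refine subsingleton_of_forall_eq 0 fun x => ?_
  obtain ⟨y, rfl⟩ := Abelian.Ext.contravariant_sequence_exact₁ h.shortExact _ x
    (n₁ := i + 1 + 1) (by omega) (Subsingleton.elim _ _)
  rw [Subsingleton.elim y 0, Abelian.Ext.comp_zero]

lemma ExtVanish.exists_extend (h : IsSES f g) (hD : ExtVanish R D X) (φ : A →ₗ[R] X) :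
    ∃ ψ : B →ₗ[R] X, ψ ∘ₗ f = φ := by
  have := hD 0
  obtain ⟨y, hy⟩ := Abelian.Ext.contravariant_sequence_exact₁ h.shortExact _
    (Abelian.Ext.mk₀ (ModuleCat.ofHom φ)) (n₁ := 1) (by omega)
    (Subsingleton.elim (α := Abelian.Ext (ModuleCat.of R D) (ModuleCat.of R X) (0 + 1)) _ _)
  obtain ⟨ψ, rfl⟩ := Abelian.Ext.addEquiv₀.symm.surjective y
  refine ⟨ψ.hom, ?_⟩
  rw [Abelian.Ext.addEquiv₀_symm_apply, Abelian.Ext.mk₀_comp_mk₀] at hy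
  exact congrArg ModuleCat.Hom.hom (Abelian.Ext.addEquiv₀.symm.injective hy)

lemma ExtVanish.exists_lift (h : IsSES f g) (hA : ExtVanish R X A) (φ : X →ₗ[R] D) :
    ∃ ψ : X →ₗ[R] B, g ∘ₗ ψ = φ := by
  have := hA 0
  obtain ⟨y, hy⟩ := Abelian.Ext.covariant_sequence_exact₃ _ h.shortExact
    (Abelian.Ext.mk₀ (ModuleCat.ofHom φ)) (n₁ := 1) (by omega)
    (Subsingleton.elim (α := Abelian.Ext (ModuleCat.of R X) (ModuleCat.of R A) (0 + 1)) _ _)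
  obtain ⟨ψ, rfl⟩ := Abelian.Ext.addEquiv₀.symm.surjective y
  refine ⟨ψ.hom, ?_⟩
  rw [Abelian.Ext.addEquiv₀_symm_apply, Abelian.Ext.mk₀_comp_mk₀] at hy
  exact congrArg ModuleCat.Hom.hom (Abelian.Ext.addEquiv₀.symm.injective hy)

lemma ExtVanish.of_middle (h : IsSES f g) (hA : ExtVanish R X A) (hD : ExtVanish R X D) :
    ExtVanish R X B := by
  intro i
  have := hA i
  have := hD i
  refine subsingleton_of_forall_eq 0 fun x => ?_
  obtain ⟨y, rfl⟩ := Abelian.Ext.covariant_sequence_exact₂ _ h.shortExact x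
    (Subsingleton.elim _ _)
  rw [Subsingleton.elim y 0, Abelian.Ext.zero_comp]

lemma ExtVanish.of_coker (h : IsSES f g) (hA : ExtVanish R X A) (hB : ExtVanish R X B) :
    ExtVanish R X D := by
  intro i
  have := hA (i + 1)
  have := hB i
  refine subsingleton_of_forall_eq 0 fun x => ?_
  obtain ⟨y, rfl⟩ := Abelian.Ext.covariant_sequence_exact₃ _ h.shortExact x
    (n₁ := i + 1 + 1) (by omega) (Subsingleton.elim _ _)
  rw [Subsingleton.elim y 0, Abelian.Ext.zero_comp]

/-- Dimension shifting: a class of modules closed under suitable syzygies, along which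
maps to `X` extend, consists of modules without positive `Ext` into `X`. -/
lemma ExtVanish.of_syzygies (Φ : ModuleCat.{u} R → Prop)
    (hΦ : ∀ D : ModuleCat.{u} R, Φ D → ∃ (A B : ModuleCat.{u} R) (f : A →ₗ[R] B) (g : B →ₗ[R] D),
      IsSES f g ∧ Φ A ∧ ExtVanish R B X ∧ ∀ φ : A →ₗ[R] X, ∃ ψ : B →ₗ[R] X, ψ ∘ₗ f = φ)
    (D : ModuleCat.{u} R) (hD : Φ D) : ExtVanish R D X := by
  intro i
  induction i generalizing D with
  | zero =>
    obtain ⟨A, B, f, g, h, -, hB, hext⟩ := hΦ D hD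
    have := hB 0
    refine subsingleton_of_forall_eq 0 fun x => ?_
    obtain ⟨y, rfl⟩ := Abelian.Ext.contravariant_sequence_exact₃ h.shortExact _ x
      (Subsingleton.elim (α := Abelian.Ext (ModuleCat.of R B) (ModuleCat.of R X) (0 + 1)) _ _)
      (n₀ := 0) (by omega)
    obtain ⟨φ, rfl⟩ := Abelian.Ext.addEquiv₀.symm.surjective y
    obtain ⟨ψ, hψ⟩ := hext φ.hom
    have hφ : φ = ModuleCat.ofHom f ≫ ModuleCat.ofHom ψ := by
      ext1; exact hψ.symm
    rw [Abelian.Ext.addEquiv₀_symm_apply, hφ, ← Abelian.Ext.mk₀_comp_mk₀]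
    exact h.shortExact.extClass_comp_assoc _
  | succ i ih =>
    obtain ⟨A, B, f, g, h, hA, hB, -⟩ := hΦ D hD
    have := hB (i + 1)
    have : Subsingleton (Abelian.Ext (ModuleCat.of R A) (ModuleCat.of R X) (i + 1)) := ih A hA
    refine subsingleton_of_forall_eq 0 fun x => ?_
    obtain ⟨y, rfl⟩ := Abelian.Ext.contravariant_sequence_exact₃ h.shortExact _ x
      (Subsingleton.elim (α := Abelian.Ext (ModuleCat.of R B) (ModuleCat.of R X) (i + 1 + 1)) _ _)
      (n₀ := i + 1) (by omega)
    rw [Subsingleton.elim y 0, Abelian.Ext.comp_zero]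

end ExtVanish

section Flat

variable {R : Type u} [CommRing R]
variable {A B D N : Type u} [AddCommGroup A] [AddCommGroup B] [AddCommGroup D] [AddCommGroup N]
  [Module R A] [Module R B] [Module R D] [Module R N]

open CharacterModule

lemma IsSES.exists_desc {f : A →ₗ[R] B} {g : B →ₗ[R] D} (h : IsSES f g) (φ : B →ₗ[R] N)
    (hφ : φ ∘ₗ f = 0) : ∃ ψ : D →ₗ[R] N, ψ ∘ₗ g = φ := by
  have hk : LinearMap.ker g ≤ LinearMap.ker φ := fun x hx => by
    obtain ⟨a, rfl⟩ := (h.exact x).1 hx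
    exact LinearMap.congr_fun hφ a
  refine ⟨(LinearMap.ker g).liftQ φ hk ∘ₗ (g.quotKerEquivOfSurjective h.surj).symm.toLinearMap, ?_⟩
  ext x
  have : (g.quotKerEquivOfSurjective h.surj).symm (g x) = Submodule.Quotient.mk x := by
    rw [LinearEquiv.symm_apply_eq]; rfl
  simp [this]

lemma IsSES.exists_factor {f : A →ₗ[R] B} {g : B →ₗ[R] D} (h : IsSES f g) (φ : N →ₗ[R] B)
    (hφ : g ∘ₗ φ = 0) : ∃ ψ : N →ₗ[R] A, f ∘ₗ ψ = φ := by
  have hr : ∀ x, φ x ∈ LinearMap.range f := fun x => (h.exact _).1 (LinearMap.congr_fun hφ x)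
  refine ⟨(LinearEquiv.ofInjective f h.inj).symm.toLinearMap ∘ₗ φ.codRestrict _ hr, ?_⟩
  ext x
  exact congrArg Subtype.val ((LinearEquiv.ofInjective f h.inj).apply_symm_apply
    (φ.codRestrict _ hr x))

lemma CharacterModule.dual_exact {f : A →ₗ[R] B} {g : B →ₗ[R] D} (h : Function.Exact f g) :
    Function.Exact (dual g) (dual f) := by
  intro c
  constructor
  · intro hc
    have hk : g.rangeRestrict.toAddMonoidHom.ker ≤ AddMonoidHom.ker c := fun x hx => by
      obtain ⟨a, rfl⟩ := (h x).1 (congrArg Subtype.val hx)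
      exact DFunLike.congr_fun hc a
    let c' : CharacterModule (LinearMap.range g) :=
      g.rangeRestrict.toAddMonoidHom.liftOfSurjective g.surjective_rangeRestrict ⟨c, hk⟩
    obtain ⟨d, hd⟩ := dual_surjective_of_injective (LinearMap.range g).subtype
      Subtype.val_injective c'
    refine ⟨d, ?_⟩
    ext x
    have h1 : c' (g.rangeRestrict x) = c x :=
      AddMonoidHom.liftOfRightInverse_comp_apply _ _ _ ⟨c, hk⟩ x
    rw [← h1, ← hd]
    rfl
  · rintro ⟨d, rfl⟩
    ext a
    change d (g (f a)) = 0
    rw [h.apply_apply_eq_zero, map_zero]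

lemma IsSES.dual {f : A →ₗ[R] B} {g : B →ₗ[R] D} (h : IsSES f g) :
    IsSES (CharacterModule.dual g) (CharacterModule.dual f) :=
  ⟨dual_injective_of_surjective g h.surj, dual_exact h.exact,
    dual_surjective_of_injective f h.inj⟩

lemma Module.Injective.of_retract [Module.Injective R B] (i : A →ₗ[R] B) (r : B →ₗ[R] A)
    (h : r ∘ₗ i = LinearMap.id) : Module.Injective R A where
  out X Y _ _ _ _ f hf g := by
    obtain ⟨k, hk⟩ := Module.Injective.out f hf (i ∘ₗ g)
    exact ⟨r ∘ₗ k, fun x => by simpa [hk] using LinearMap.congr_fun h (g x)⟩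

lemma IsSES.exists_retraction {f : A →ₗ[R] B} {g : B →ₗ[R] D} (h : IsSES f g)
    [Module.Injective R A] : ∃ l, l ∘ₗ f = LinearMap.id := by
  obtain ⟨l, hl⟩ := Module.Injective.out f h.inj LinearMap.id
  exact ⟨l, LinearMap.ext hl⟩

lemma IsSES.exists_section_of_retraction {f : A →ₗ[R] B} {g : B →ₗ[R] D} (h : IsSES f g)
    (hl : ∃ l, l ∘ₗ f = LinearMap.id) : ∃ l, g ∘ₗ l = LinearMap.id :=
  ((h.exact.split_tfae h.inj h.surj).out 0 1).2 hl

lemma IsSES.exists_retraction_of_section {f : A →ₗ[R] B} {g : B →ₗ[R] D} (h : IsSES f g)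
    (hl : ∃ l, g ∘ₗ l = LinearMap.id) : ∃ l, l ∘ₗ f = LinearMap.id :=
  ((h.exact.split_tfae h.inj h.surj).out 0 1).1 hl

lemma IsSES.injective_middle {f : A →ₗ[R] B} {g : B →ₗ[R] D} (h : IsSES f g)
    [Module.Injective R A] [Module.Injective R D] : Module.Injective R B where
  out X Y _ _ _ _ i hi u := by
    obtain ⟨e, -⟩ := ((h.exact.split_tfae h.inj h.surj).out 1 2).1 h.exists_retraction
    obtain ⟨p, hp⟩ := Module.Injective.out i hi (LinearMap.fst R A D ∘ₗ e.toLinearMap ∘ₗ u)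
    obtain ⟨q, hq⟩ := Module.Injective.out i hi (LinearMap.snd R A D ∘ₗ e.toLinearMap ∘ₗ u)
    refine ⟨e.symm.toLinearMap ∘ₗ p.prod q, fun x => ?_⟩
    simp [hp, hq]

lemma IsSES.exists_section_dual {f : A →ₗ[R] B} {g : B →ₗ[R] D} (h : IsSES f g)
    [Module.Flat R D] : ∃ s, CharacterModule.dual f ∘ₗ s = LinearMap.id := by
  have : Module.Injective R (CharacterModule D) :=
    Module.Flat.iff_characterModule_injective.1 inferInstance
  exact h.dual.exists_section_of_retraction h.dual.exists_retraction

lemma IsSES.flat_ker {f : A →ₗ[R] B} {g : B →ₗ[R] D} (h : IsSES f g)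
    [Module.Flat R B] [Module.Flat R D] : Module.Flat R A := by
  have : Module.Injective R (CharacterModule B) :=
    Module.Flat.iff_characterModule_injective.1 inferInstance
  obtain ⟨s, hs⟩ := h.exists_section_dual
  exact Module.Flat.iff_characterModule_injective.2 (.of_retract s _ hs)

lemma IsSES.flat_middle {f : A →ₗ[R] B} {g : B →ₗ[R] D} (h : IsSES f g)
    [Module.Flat R A] [Module.Flat R D] : Module.Flat R B := by
  have : Module.Injective R (CharacterModule A) :=
    Module.Flat.iff_characterModule_injective.1 inferInstance
  have : Module.Injective R (CharacterModule D) :=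
    Module.Flat.iff_characterModule_injective.1 inferInstance
  exact Module.Flat.iff_characterModule_injective.2 h.dual.injective_middle

/-- Swapping the arguments of a linear map into a character module. -/
def CharacterModule.flip (φ : A →ₗ[R] CharacterModule N) : N →ₗ[R] CharacterModule A where
  toFun n := ((AddMonoidHom.eval n).comp φ.toAddMonoidHom : A →+ AddCircle (1 : ℚ))
  map_add' m n := by
    ext a
    exact map_add (φ a) m n
  map_smul' r n := by
    ext a
    exact (DFunLike.congr_fun (φ.map_smul r a) n).symm

lemma IsSES.exists_extend_characterModule {f : A →ₗ[R] B} {g : B →ₗ[R] D} (h : IsSES f g)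
    [Module.Flat R D] (φ : A →ₗ[R] CharacterModule N) :
    ∃ ψ : B →ₗ[R] CharacterModule N, ψ ∘ₗ f = φ := by
  obtain ⟨s, hs⟩ := h.exists_section_dual
  refine ⟨CharacterModule.flip (s ∘ₗ CharacterModule.flip φ), ?_⟩
  ext a n
  exact DFunLike.congr_fun (LinearMap.congr_fun hs (CharacterModule.flip φ n)) a

lemma IsSES.rTensor_of_flat {f : A →ₗ[R] B} {g : B →ₗ[R] D} (h : IsSES f g) (N : Type u)
    [AddCommGroup N] [Module R N] [Module.Flat R D] :
    IsSES (f.rTensor N) (g.rTensor N) :=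
  ⟨rTensor_injective_iff_lcomp_surjective.2 h.exists_extend_characterModule,
    rTensor_exact N h.exact h.surj, LinearMap.rTensor_surjective N h.surj⟩

/-- The map from a module to its double character module. -/
def CharacterModule.toDoubleDual (R A : Type u) [CommRing R] [AddCommGroup A] [Module R A] :
    A →ₗ[R] CharacterModule (CharacterModule A) :=
  CharacterModule.flip LinearMap.id

lemma CharacterModule.toDoubleDual_injective :
    Function.Injective (toDoubleDual R A) :=
  (injective_iff_map_eq_zero _).2 fun _ ha =>
    eq_zero_of_character_apply fun c => DFunLike.congr_fun ha c

lemma CharacterModule.flat_of_injective [IsNoetherianRing R] [Module.Injective R A] :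
    Module.Flat R (CharacterModule A) := by
  refine Module.Flat.of_forall_isTrivialRelation fun {l f x} hfx => ?_
  let p : (Fin l → R) →ₗ[R] R := Fintype.linearCombination R f
  obtain ⟨k, a, ha⟩ := Submodule.fg_iff_exists_fin_generating_family.1
    (IsNoetherian.noetherian (LinearMap.ker p))
  let α : A →ₗ[R] (Fin l → A) := LinearMap.pi fun i => f i • LinearMap.id
  let β : (Fin l → A) →ₗ[R] (Fin k → A) :=
    LinearMap.pi fun j => ∑ i, a j i • LinearMap.proj i
  have hexact : Function.Exact α β := by
    intro t
    constructor
    · intro ht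
      let q : (Fin l → R) →ₗ[R] A := Fintype.linearCombination R t
      have hk : LinearMap.ker p ≤ LinearMap.ker q := by
        rw [← ha, Submodule.span_le]
        rintro _ ⟨j, rfl⟩
        simpa [β, q, Fintype.linearCombination_apply] using congrFun ht j
      let q' : LinearMap.range p →ₗ[R] A :=
        (LinearMap.ker p).liftQ q hk ∘ₗ p.quotKerEquivRange.symm.toLinearMap
      obtain ⟨v, hv⟩ := Module.Injective.out (LinearMap.range p).subtype Subtype.val_injective q'
      refine ⟨v 1, ?_⟩
      ext i
      have h1 : p (Pi.single i 1) = f i := by simp [p]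
      have h2 : q (Pi.single i 1) = t i := by simp [q]
      have h3 := hv ⟨p (Pi.single i 1), LinearMap.mem_range_self p _⟩
      have h4 : p.quotKerEquivRange.symm ⟨p (Pi.single i 1), LinearMap.mem_range_self p _⟩ =
          Submodule.Quotient.mk (Pi.single i 1) := by
        rw [LinearEquiv.symm_apply_eq]; rfl
      simp only [q', LinearMap.comp_apply, LinearEquiv.coe_coe, h4] at h3
      change f i • v 1 = t i
      rw [← h2, ← map_smul, smul_eq_mul, mul_one, ← h1]
      exact h3
    · rintro ⟨s, rfl⟩
      ext j
      have hj : p (a j) = 0 := by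
        have : a j ∈ LinearMap.ker p := ha ▸ Submodule.subset_span ⟨j, rfl⟩
        exact this
      have : ∑ i, a j i • f i • s = 0 := by
        simp only [p, Fintype.linearCombination_apply, smul_eq_mul] at hj
        simp only [smul_smul, ← Finset.sum_smul, hj, zero_smul]
      simpa [α, β] using this
  let X : CharacterModule (Fin l → A) :=
    (∑ i, (x i : A →+ AddCircle (1 : ℚ)).comp (Pi.evalAddMonoidHom (fun _ => A) i) :
      (Fin l → A) →+ AddCircle (1 : ℚ))
  have hX (t : Fin l → A) : X t = ∑ i, x i (t i) :=
    AddMonoidHom.finsetSum_apply _ _ _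
  obtain ⟨Y, hY⟩ := (dual_exact hexact X).1 (by
    ext s
    have h1 : (∑ i, f i • x i) s = ∑ i, (f i • x i) s := AddMonoidHom.finsetSum_apply _ _ _
    rw [hfx] at h1
    exact (hX _).trans h1.symm)
  refine ⟨k, fun i j => a j i, fun j => dual (LinearMap.single R (fun _ => A) j) Y, fun i => ?_,
    fun j => ?_⟩
  · ext t
    have h1 : x i t = X (Pi.single i t) := by
      rw [hX, Finset.sum_eq_single i] <;> simp +contextual
    have h2 : β (Pi.single i t) = ∑ j, Pi.single j (a j i • t) := by
      rw [Finset.univ_sum_single]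
      ext j
      simp [β, Pi.single_apply]
    rw [h1, ← hY]
    change Y (β _) = _
    rw [h2, map_sum]
    have h3 : (∑ j, a j i • dual (LinearMap.single R (fun _ => A) j) Y) t =
        ∑ j, (a j i • dual (LinearMap.single R (fun _ => A) j) Y) t :=
      AddMonoidHom.finsetSum_apply _ _ _
    exact h3.symm
  · have : a j ∈ LinearMap.ker p := ha ▸ Submodule.subset_span ⟨j, rfl⟩
    simpa [p, Fintype.linearCombination_apply, mul_comm] using this

lemma CharacterModule.flat_doubleDual [IsNoetherianRing R] [Module.Flat R A] :
    Module.Flat R (CharacterModule (CharacterModule A)) := by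
  have : Module.Injective R (CharacterModule A) :=
    Module.Flat.iff_characterModule_injective.1 inferInstance
  exact flat_of_injective

lemma CharacterModule.flat_coker_toDoubleDual [IsNoetherianRing R] [Module.Flat R A] :
    Module.Flat R (CharacterModule (CharacterModule A) ⧸ LinearMap.range (toDoubleDual R A)) := by
  have h := isSES_range (toDoubleDual_injective (R := R) (A := A))
  have : Module.Flat R (CharacterModule (CharacterModule A)) := flat_doubleDual
  have : Module.Injective R (CharacterModule (CharacterModule (CharacterModule A))) :=
    Module.Flat.iff_characterModule_injective.1 inferInstance
  obtain ⟨l, hl⟩ := h.dual.exists_retraction_of_section ⟨toDoubleDual R (CharacterModule A), rfl⟩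
  exact Module.Flat.iff_characterModule_injective.2 (.of_retract _ l hl)

end Flat

section HomTensor

variable {R : Type u} [CommRing R]
variable {A B D F X : Type u} [AddCommGroup A] [AddCommGroup B] [AddCommGroup D] [AddCommGroup F]
  [AddCommGroup X] [Module R A] [Module R B] [Module R D] [Module R F] [Module R X]

lemma LinearMap.lcomp_injective {g : B →ₗ[R] D} (hg : Function.Surjective g) :
    Function.Injective (LinearMap.lcomp R X g) :=
  fun _ _ h => (LinearMap.cancel_right hg).1 h

lemma IsSES.lcomp_exact {f : A →ₗ[R] B} {g : B →ₗ[R] D} (h : IsSES f g) :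
    Function.Exact (LinearMap.lcomp R X g) (LinearMap.lcomp R X f) := by
  intro φ
  constructor
  · exact fun hφ => h.exists_desc φ hφ
  · rintro ⟨ψ, rfl⟩
    change (ψ ∘ₗ g) ∘ₗ f = 0
    rw [LinearMap.comp_assoc, h.comp_eq_zero, LinearMap.comp_zero]

lemma TensorProduct.lTensorHomToHomLTensor_natural (f : A →ₗ[R] B) :
    LinearMap.lcomp R (F ⊗[R] X) f ∘ₗ lTensorHomToHomLTensor (.id R) B F X =
      lTensorHomToHomLTensor (.id R) A F X ∘ₗ (LinearMap.lcomp R X f).lTensor F := by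
  ext
  rfl

lemma TensorProduct.lTensorHomToHomLTensor_bijective_of_projective [Module.Finite R A]
    [Module.Projective R A] :
    Function.Bijective (lTensorHomToHomLTensor (.id R) A F X) := by
  rw [← lTensorHomEquivHomLTensor_toLinearMap]
  exact (lTensorHomEquivHomLTensor R A F X).bijective

lemma TensorProduct.lTensorHomToHomLTensor_injective [Module.Finite R A] [Module.Flat R F] :
    Function.Injective (lTensorHomToHomLTensor (.id R) A F X) := by
  obtain ⟨n, p, hp⟩ := Module.Finite.exists_fin' R A
  have h1 := lTensorHomToHomLTensor_natural (F := F) (X := X) p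
  have h2 : Function.Injective ((LinearMap.lcomp R X p).lTensor F) :=
    Module.Flat.lTensor_preserves_injective_linearMap _ (LinearMap.lcomp_injective hp)
  have h3 := (lTensorHomToHomLTensor_bijective_of_projective
    (R := R) (A := Fin n → R) (F := F) (X := X)).1.comp h2
  rw [← LinearMap.coe_comp, ← h1, LinearMap.coe_comp] at h3
  exact h3.of_comp

/-- Over a noetherian ring, tensoring with a flat module commutes with `Hom` out of a finite
module. -/
lemma TensorProduct.lTensorHomToHomLTensor_bijective [IsNoetherianRing R] [Module.Finite R A]
    [Module.Flat R F] : Function.Bijective (lTensorHomToHomLTensor (.id R) A F X) := by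
  obtain ⟨n, p, hp⟩ := Module.Finite.exists_fin' R A
  have h := isSES_ker hp
  exact LinearMap.bijective_of_bijective_of_injective_of_left_exact
    ((LinearMap.lcomp R X p).lTensor F) ((LinearMap.lcomp R X (LinearMap.ker p).subtype).lTensor F)
    (LinearMap.lcomp R (F ⊗[R] X) p) (LinearMap.lcomp R (F ⊗[R] X) (LinearMap.ker p).subtype)
    _ _ _ (lTensorHomToHomLTensor_natural p)
    (lTensorHomToHomLTensor_natural (LinearMap.ker p).subtype)
    (Module.Flat.lTensor_exact F h.lcomp_exact) h.lcomp_exact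
    lTensorHomToHomLTensor_bijective_of_projective lTensorHomToHomLTensor_injective
    (Module.Flat.lTensor_preserves_injective_linearMap _ (LinearMap.lcomp_injective hp))
    (LinearMap.lcomp_injective hp)

lemma ExtVanish.tensor_of_flat [IsNoetherianRing R] [Module.Finite R A] [Module.Flat R F]
    (h : ExtVanish R A X) : ExtVanish R A (F ⊗[R] X) := by
  refine ExtVanish.of_syzygies (X := F ⊗[R] X)
    (fun D => Module.Finite R D ∧ ExtVanish R D X) ?_ (ModuleCat.of R A) ⟨inferInstance, h⟩
  rintro D ⟨hD, hDX⟩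
  obtain ⟨n, p, hp⟩ := Module.Finite.exists_fin' R D
  have hs := isSES_ker hp
  refine ⟨ModuleCat.of R (LinearMap.ker p), ModuleCat.of R (Fin n → R),
    (LinearMap.ker p).subtype, p, hs, ⟨inferInstance, .of_ker hs .of_projective hDX⟩,
    .of_projective, fun φ => ?_⟩
  obtain ⟨t, rfl⟩ := lTensorHomToHomLTensor_bijective.2 φ
  obtain ⟨s, rfl⟩ := LinearMap.lTensor_surjective F (g := LinearMap.lcomp R X
    (LinearMap.ker p).subtype) (fun φ => ExtVanish.exists_extend hs hDX φ) t
  exact ⟨lTensorHomToHomLTensor (.id R) _ F X s,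
    LinearMap.congr_fun (lTensorHomToHomLTensor_natural (LinearMap.ker p).subtype) s⟩

end HomTensor

section Semidualizing

variable {R : Type u} [CommRing R] [IsNoetherianRing R]
variable {C : Type u} [AddCommGroup C] [Module R C] [Module.Finite R C]
variable {F T : Type u} [AddCommGroup F] [Module R F] [AddCommGroup T] [Module R T]

lemma TensorProduct.mk_bijective_of_flat (hC : Function.Bijective (LinearMap.lsmul R C))
    [Module.Flat R F] : Function.Bijective (TensorProduct.mk R F C) := by
  let e := LinearEquiv.ofBijective (LinearMap.lsmul R C : R →ₗ[R] C →ₗ[R] C) hC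
  have : TensorProduct.mk R F C = lTensorHomToHomLTensor (.id R) C F C ∘ₗ
      (e.lTensor F).toLinearMap ∘ₗ (TensorProduct.rid R F).symm.toLinearMap := by
    ext x c
    simp [e]
  rw [this]
  exact lTensorHomToHomLTensor_bijective.comp
    ((e.lTensor F).bijective.comp (TensorProduct.rid R F).symm.bijective)

lemma subsingleton_of_subsingleton_linearMap (hC : Function.Injective (LinearMap.lsmul R C))
    (hT : Subsingleton (C →ₗ[R] T)) : Subsingleton T := by
  refine subsingleton_of_forall_eq 0 fun t => ?_
  have : Subsingleton (C →ₗ[R] Submodule.span R {t}) := by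
    refine ⟨fun φ ψ => ?_⟩
    have := Subsingleton.elim ((Submodule.span R {t}).subtype ∘ₗ φ)
      ((Submodule.span R {t}).subtype ∘ₗ ψ)
    exact (LinearMap.cancel_left Subtype.val_injective).1 this
  obtain ⟨r, hr, hreg⟩ := IsSMulRegular.subsingleton_linearMap_iff.1 this
  have hr0 : r = 0 := hC <| by
    ext c
    simpa using Module.mem_annihilator.1 hr c
  subst hr0
  have : (⟨t, Submodule.mem_span_singleton_self t⟩ : Submodule.span R {t}) = 0 :=
    hreg (by simp)
  exact congrArg Subtype.val this

end Semidualizing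

section AuslanderBass

variable {R : Type u} [CommRing R]

/-- The condition that `K` is recovered from `K ⊗ C` by `Hom(C, -)`, with no higher `Ext`. -/
def IsAuslander (R C K : Type u) [CommRing R] [AddCommGroup C] [AddCommGroup K] [Module R C]
    [Module R K] : Prop :=
  ExtVanish R C (K ⊗[R] C) ∧ Function.Bijective (TensorProduct.mk R K C)

/-- Evaluation `Hom(C, M) ⊗ C → M`. -/
noncomputable def homEval (R C M : Type u) [CommRing R] [AddCommGroup C] [AddCommGroup M]
    [Module R C] [Module R M] : (C →ₗ[R] M) ⊗[R] C →ₗ[R] M :=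
  TensorProduct.lift LinearMap.id

/-- The condition that `M` is recovered from `Hom(C, M)` by `- ⊗ C`, with no higher `Ext`. -/
def IsBass (R C M : Type u) [CommRing R] [AddCommGroup C] [AddCommGroup M] [Module R C]
    [Module R M] : Prop :=
  ExtVanish R C M ∧ Function.Bijective (homEval R C M)

variable {A B C D M F X : Type u} [AddCommGroup A] [AddCommGroup B] [AddCommGroup C]
  [AddCommGroup D] [AddCommGroup F] [AddCommGroup X] [AddCommGroup M] [Module R A] [Module R B]
  [Module R C] [Module R D] [Module R F] [Module R X] [Module R M]

lemma LinearMap.compRight_exact {f : A →ₗ[R] B} {g : B →ₗ[R] D} (h : IsSES f g) :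
    Function.Exact (LinearMap.compRight (M := X) R f) (LinearMap.compRight (M := X) R g) := by
  intro φ
  constructor
  · exact fun hφ => h.exists_factor φ hφ
  · rintro ⟨ψ, rfl⟩
    change g ∘ₗ (f ∘ₗ ψ) = 0
    rw [← LinearMap.comp_assoc, h.comp_eq_zero, LinearMap.zero_comp]

lemma IsSES.compRight {f : A →ₗ[R] B} {g : B →ₗ[R] D} (h : IsSES f g) (hA : ExtVanish R X A) :
    IsSES (LinearMap.compRight (M := X) R f) (LinearMap.compRight (M := X) R g) :=
  ⟨fun _ _ hφ => (LinearMap.cancel_left h.inj).1 hφ, LinearMap.compRight_exact h,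
    fun φ => ExtVanish.exists_lift h hA φ⟩

lemma IsAuslander.of_flat [IsNoetherianRing R] [Module.Finite R C]
    (hC : Function.Bijective (LinearMap.lsmul R C)) (hCC : ExtVanish R C C) [Module.Flat R F] :
    IsAuslander R C F :=
  ⟨hCC.tensor_of_flat, TensorProduct.mk_bijective_of_flat hC⟩

lemma IsAuslander.isSES_rTensor [IsNoetherianRing R] [Module.Finite R C]
    (hC : Function.Injective (LinearMap.lsmul R C)) {f : A →ₗ[R] B} {g : B →ₗ[R] D}
    (h : IsSES f g) (hA : IsAuslander R C A) (hB : IsAuslander R C B) :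
    IsSES (f.rTensor C) (g.rTensor C) := by
  refine ⟨?_, rTensor_exact C h.exact h.surj, LinearMap.rTensor_surjective C h.surj⟩
  have : Subsingleton (C →ₗ[R] LinearMap.ker (f.rTensor C)) := by
    refine subsingleton_of_forall_eq 0 fun φ => ?_
    obtain ⟨x, hx⟩ := hA.2.2 ((LinearMap.ker (f.rTensor C)).subtype ∘ₗ φ)
    have h1 : TensorProduct.mk R B C (f x) = 0 := by
      ext c
      have h2 : f.rTensor C (TensorProduct.mk R A C x c) = 0 := by
        rw [hx]
        exact (φ c).2
      exact h2
    have h3 : x = 0 := h.inj (hB.2.1 (by rw [h1, map_zero, map_zero]))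
    rw [h3, map_zero] at hx
    exact (LinearMap.cancel_left Subtype.val_injective).1 (hx.symm.trans
      (LinearMap.comp_zero (LinearMap.ker (f.rTensor C)).subtype).symm)
  have := subsingleton_of_subsingleton_linearMap hC this
  exact LinearMap.ker_eq_bot.1 (Submodule.subsingleton_iff_eq_bot.1 this)

lemma IsAuslander.of_ses [IsNoetherianRing R] [Module.Finite R C]
    (hC : Function.Injective (LinearMap.lsmul R C)) {f : A →ₗ[R] B} {g : B →ₗ[R] D}
    (h : IsSES f g) (hA : IsAuslander R C A) (hB : IsAuslander R C B) :
    IsAuslander R C D := by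
  have ht := hA.isSES_rTensor hC h hB
  have hh := ht.compRight hA.1
  refine ⟨.of_coker ht hA.1 hB.1, ?_⟩
  exact LinearMap.bijective_of_surjective_of_bijective_of_right_exact f g
    (LinearMap.compRight R (f.rTensor C)) (LinearMap.compRight R (g.rTensor C))
    (TensorProduct.mk R A C) (TensorProduct.mk R B C) (TensorProduct.mk R D C) rfl rfl
    h.exact hh.exact hA.2.2 hB.2 h.surj hh.surj

lemma IsBass.of_ses {f : A →ₗ[R] B} {g : B →ₗ[R] D}
    (h : IsSES f g) (hA : IsBass R C A) (hB : IsBass R C B) : IsBass R C D := by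
  have hh := h.compRight (X := C) hA.1
  refine ⟨.of_coker h hA.1 hB.1, ?_⟩
  exact LinearMap.bijective_of_surjective_of_bijective_of_right_exact
    ((LinearMap.compRight R f).rTensor C) ((LinearMap.compRight R g).rTensor C) f g
    (homEval R C A) (homEval R C B) (homEval R C D)
    (TensorProduct.ext' fun _ _ => rfl) (TensorProduct.ext' fun _ _ => rfl)
    (rTensor_exact C hh.exact hh.surj) h.exact hA.2.2 hB.2
    (LinearMap.rTensor_surjective C hh.surj) h.surj

lemma IsAuslander.isBass (h : IsAuslander R C A) : IsBass R C (A ⊗[R] C) := by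
  refine ⟨h.1, ?_⟩
  let e := (LinearEquiv.ofBijective _ h.2).rTensor C
  have : homEval R C (A ⊗[R] C) ∘ e = id :=
    congrArg DFunLike.coe (TensorProduct.ext' fun _ _ => rfl :
      homEval R C (A ⊗[R] C) ∘ₗ e.toLinearMap = LinearMap.id)
  exact (e.bijective.of_comp_iff _).1 (this ▸ Function.bijective_id)

lemma IsBass.of_equiv (e : A ≃ₗ[R] B) (h : IsBass R C A) : IsBass R C B := by
  refine ⟨h.1.of_equiv_right e, ?_⟩
  let e' := (e.congrRight : (C →ₗ[R] A) ≃ₗ[R] (C →ₗ[R] B)).rTensor C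
  have : homEval R C B ∘ e' = e ∘ homEval R C A :=
    congrArg DFunLike.coe (TensorProduct.ext' fun _ _ => rfl :
      homEval R C B ∘ₗ e'.toLinearMap = e.toLinearMap ∘ₗ homEval R C A)
  exact (e'.bijective.of_comp_iff _).1 (this ▸ e.bijective.comp h.2)

end AuslanderBass

section Cotorsion

variable {R : Type u} [CommRing R]

/-- The unbundled form of `IsCotorsion`. -/
def IsCotorsionModule (R X : Type u) [CommRing R] [AddCommGroup X] [Module R X] : Prop :=
  ∀ (F : Type u) [AddCommGroup F] [Module R F], Module.Flat R F → ExtVanish R F X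

lemma isCotorsion_iff (X : ModuleCat.{u} R) : IsCotorsion R X ↔ IsCotorsionModule R X :=
  ⟨fun h F _ _ hF => (extZero_iff (ModuleCat.of R F) X).1 (h (ModuleCat.of R F) hF),
    fun h F hF => (extZero_iff F X).2 (h F hF)⟩

variable {A B C D F N P X : Type u} [AddCommGroup A] [AddCommGroup B] [AddCommGroup C]
  [AddCommGroup D] [AddCommGroup F] [AddCommGroup N] [AddCommGroup P] [AddCommGroup X]
  [Module R A] [Module R B] [Module R C] [Module R D] [Module R F] [Module R N] [Module R P]
  [Module R X]

lemma IsCotorsionModule.of_equiv (e : A ≃ₗ[R] B) (h : IsCotorsionModule R A) :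
    IsCotorsionModule R B :=
  fun F _ _ hF => (h F hF).of_equiv_right e

lemma IsCotorsionModule.of_middle {f : A →ₗ[R] B} {g : B →ₗ[R] D} (h : IsSES f g)
    (hA : IsCotorsionModule R A) (hD : IsCotorsionModule R D) : IsCotorsionModule R B :=
  fun F _ _ hF => .of_middle h (hA F hF) (hD F hF)

lemma IsCotorsionModule.of_coker {f : A →ₗ[R] B} {g : B →ₗ[R] D} (h : IsSES f g)
    (hA : IsCotorsionModule R A) (hB : IsCotorsionModule R B) : IsCotorsionModule R D :=
  fun F _ _ hF => .of_coker h (hA F hF) (hB F hF)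

/-- A module is cotorsion as soon as maps into it extend along inclusions with flat cokernel. -/
lemma IsCotorsionModule.of_extend
    (h : ∀ (A B D : Type u) [AddCommGroup A] [AddCommGroup B] [AddCommGroup D] [Module R A]
      [Module R B] [Module R D] (f : A →ₗ[R] B) (g : B →ₗ[R] D), IsSES f g → Module.Flat R D →
      ∀ φ : A →ₗ[R] X, ∃ ψ : B →ₗ[R] X, ψ ∘ₗ f = φ) : IsCotorsionModule R X := by
  intro F _ _ hF
  refine ExtVanish.of_syzygies (fun D => Module.Flat R D) ?_ (ModuleCat.of R F) hF
  intro D hD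
  have hs := isSES_ker (Finsupp.linearCombination_id_surjective R D)
  exact ⟨ModuleCat.of R (LinearMap.ker _), ModuleCat.of R (D →₀ R), _, _, hs, hs.flat_ker,
    .of_projective, h _ _ _ _ _ hs hD⟩

lemma IsCotorsionModule.characterModule : IsCotorsionModule R (CharacterModule N) :=
  .of_extend fun _ _ _ _ _ _ _ _ _ _ _ h _ φ => h.exists_extend_characterModule φ

lemma IsSES.lTensor (P : Type u) [AddCommGroup P] [Module R P] [Module.Flat R P] {f : A →ₗ[R] B}
    {g : B →ₗ[R] D} (h : IsSES f g) : IsSES (f.lTensor P) (g.lTensor P) :=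
  ⟨Module.Flat.lTensor_preserves_injective_linearMap _ h.inj, lTensor_exact P h.exact h.surj,
    LinearMap.lTensor_surjective P h.surj⟩

lemma ExtVanish.exists_extend_lTensor [Module.Projective R P] {f : A →ₗ[R] B} {g : B →ₗ[R] D}
    (h : IsSES f g) (hD : ExtVanish R D X) (φ : P ⊗[R] A →ₗ[R] X) :
    ∃ ψ : P ⊗[R] B →ₗ[R] X, ψ ∘ₗ f.lTensor P = φ := by
  obtain ⟨ψ, hψ⟩ := Module.projective_lifting_property (LinearMap.lcomp R X f)
    (TensorProduct.curry φ) (fun φ => ExtVanish.exists_extend h hD φ)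
  exact ⟨TensorProduct.lift ψ, TensorProduct.ext' fun x y =>
    LinearMap.congr_fun (LinearMap.congr_fun hψ x) y⟩

lemma ExtVanish.tensor_left_of_projective [Module.Projective R P] (h : ExtVanish R A X) :
    ExtVanish R (P ⊗[R] A) X := by
  refine ExtVanish.of_syzygies
    (fun D => ∃ A : ModuleCat.{u} R, ExtVanish R A X ∧ D = ModuleCat.of R (P ⊗[R] A)) ?_
    (ModuleCat.of R (P ⊗[R] A)) ⟨ModuleCat.of R A, h, rfl⟩
  rintro _ ⟨A, hA, rfl⟩
  obtain ⟨K, B, f, g, hB, hs⟩ : ∃ (K B : ModuleCat.{u} R) (f : K →ₗ[R] B) (g : B →ₗ[R] A),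
      Module.Projective R B ∧ IsSES f g :=
    ⟨ModuleCat.of R (LinearMap.ker _), ModuleCat.of R (A →₀ R), _, _, inferInstance,
      isSES_ker (Finsupp.linearCombination_id_surjective R A)⟩
  exact ⟨ModuleCat.of R (P ⊗[R] K), ModuleCat.of R (P ⊗[R] B), f.lTensor P, g.lTensor P,
    hs.lTensor P, ⟨K, .of_ker hs .of_projective hA, rfl⟩, .of_projective,
    ExtVanish.exists_extend_lTensor hs hA⟩

lemma ExtVanish.tensor_left_of_flat (hX : ExtVanish R C X)
    (hcot : IsCotorsionModule R (C →ₗ[R] X)) [Module.Flat R F] : ExtVanish R (F ⊗[R] C) X := by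
  refine ExtVanish.of_syzygies
    (fun D => ∃ F : ModuleCat.{u} R, Module.Flat R F ∧ D = ModuleCat.of R (F ⊗[R] C)) ?_
    (ModuleCat.of R (F ⊗[R] C)) ⟨ModuleCat.of R F, inferInstance, rfl⟩
  rintro _ ⟨F, hF, rfl⟩
  have hs := isSES_ker (Finsupp.linearCombination_id_surjective R F)
  refine ⟨ModuleCat.of R (LinearMap.ker _ ⊗[R] C), ModuleCat.of R ((F →₀ R) ⊗[R] C),
    _, _, hs.rTensor_of_flat C, ⟨ModuleCat.of R (LinearMap.ker _), hs.flat_ker, rfl⟩,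
    hX.tensor_left_of_projective, fun φ => ?_⟩
  obtain ⟨ψ, hψ⟩ := ExtVanish.exists_extend hs (hcot F hF) (TensorProduct.curry φ)
  exact ⟨TensorProduct.lift ψ, TensorProduct.ext' fun x y =>
    LinearMap.congr_fun (LinearMap.congr_fun hψ x) y⟩

lemma IsCotorsionModule.hom_of_tensor
    (h : ∀ (F : Type u) [AddCommGroup F] [Module R F], Module.Flat R F →
      ExtVanish R (F ⊗[R] C) X) : IsCotorsionModule R (C →ₗ[R] X) := by
  refine .of_extend fun A B D _ _ _ _ _ _ f g hs hD φ => ?_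
  obtain ⟨ψ, hψ⟩ := ExtVanish.exists_extend (hs.rTensor_of_flat C) (h D hD) (TensorProduct.lift φ)
  refine ⟨TensorProduct.curry ψ, ?_⟩
  ext x y
  exact LinearMap.congr_fun hψ (x ⊗ₜ y)

end Cotorsion

section Resolutions

variable {R : Type u} [CommRing R]

/-- The recursive form of `HasResOfLength`. -/
def HasRes (𝒳 : ModuleCat.{u} R → Prop) : ℕ → ModuleCat.{u} R → Prop
  | 0, M => 𝒳 M
  | n + 1, M => ∃ (K X : ModuleCat.{u} R) (f : K →ₗ[R] X) (g : X →ₗ[R] M),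
      IsSES f g ∧ 𝒳 X ∧ HasRes 𝒳 n K

/-- Invariance of a class of modules under isomorphism. -/
def IsoInvariant (𝒳 : ModuleCat.{u} R → Prop) : Prop :=
  ∀ A B : ModuleCat.{u} R, Nonempty (A ≃ₗ[R] B) → 𝒳 A → 𝒳 B

variable {A B D : Type u} [AddCommGroup A] [AddCommGroup B] [AddCommGroup D]
  [Module R A] [Module R B] [Module R D]

lemma IsSES.comp_equiv {f : A →ₗ[R] B} {g : B →ₗ[R] D} (h : IsSES f g) {N : Type u}
    [AddCommGroup N] [Module R N] (e : D ≃ₗ[R] N) : IsSES f (e.toLinearMap ∘ₗ g) :=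
  ⟨h.inj, fun x => by simpa using h.exact x, e.surjective.comp h.surj⟩

lemma HasRes.of_equiv {𝒳 : ModuleCat.{u} R → Prop} (h𝒳 : IsoInvariant 𝒳) {n : ℕ}
    {M N : ModuleCat.{u} R} (e : M ≃ₗ[R] N) (h : HasRes 𝒳 n M) : HasRes 𝒳 n N := by
  cases n with
  | zero => exact h𝒳 M N ⟨e⟩ h
  | succ n =>
    obtain ⟨K, X, f, g, hs, hX, hK⟩ := h
    exact ⟨K, X, f, _, hs.comp_equiv e, hX, hK⟩

lemma HasResOfLength.hasRes {𝒳 : ModuleCat.{u} R → Prop} (h𝒳 : IsoInvariant 𝒳) {n : ℕ}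
    {M : ModuleCat.{u} R} (h : HasResOfLength R 𝒳 n M) : HasRes 𝒳 n M := by
  induction n generalizing M with
  | zero =>
    obtain ⟨P, d, ε, hε, h0, -, hX, hP⟩ := h
    have := hP 1 one_pos
    refine h𝒳 (P 0) M ⟨LinearEquiv.ofBijective ε ⟨?_, hε⟩⟩ (hX 0 le_rfl)
    refine (injective_iff_map_eq_zero ε).2 fun x hx => ?_
    obtain ⟨y, rfl⟩ := (h0 x).1 hx
    rw [Subsingleton.elim y 0, map_zero]
  | succ n ih =>
    obtain ⟨P, d, ε, hε, h0, hd, hX, hP⟩ := h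
    refine ⟨ModuleCat.of R (LinearMap.ker ε), P 0, _, ε, isSES_ker hε, hX 0 (Nat.zero_le _),
      ih ⟨fun i => P (i + 1), fun i => d (i + 1),
        (d 0).codRestrict (LinearMap.ker ε) fun x => h0.apply_apply_eq_zero x, ?_, ?_,
        fun i => hd (i + 1), fun i hi => hX _ (by omega), fun i hi => hP _ (by omega)⟩⟩
    · rintro ⟨x, hx⟩
      obtain ⟨y, rfl⟩ := (h0 x).1 hx
      exact ⟨y, rfl⟩
    · intro x
      rw [← hd 0 x, Subtype.ext_iff]
      rfl

lemma HasRes.hasResOfLength {𝒳 : ModuleCat.{u} R → Prop} {n : ℕ}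
    {M : ModuleCat.{u} R} (h : HasRes 𝒳 n M) : HasResOfLength R 𝒳 n M := by
  induction n generalizing M with
  | zero =>
    let P : ℕ → ModuleCat.{u} R
      | 0 => M
      | _ + 1 => ModuleCat.of R PUnit
    have hP (i : ℕ) : Subsingleton (P (i + 1)) := inferInstanceAs (Subsingleton PUnit)
    refine ⟨P, fun i => 0, (LinearMap.id : M →ₗ[R] M), Function.surjective_id, ?_,
      fun i x => ?_, fun i hi => ?_, fun i hi => ?_⟩
    · exact fun x => ⟨fun hx => ⟨0, hx.symm⟩, fun ⟨y, hy⟩ => hy.symm⟩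
    · exact ⟨fun _ => ⟨0, Subsingleton.elim _ _⟩, fun _ => rfl⟩
    · obtain rfl : i = 0 := by omega
      exact h
    · obtain ⟨j, rfl⟩ : ∃ j, i = j + 1 := ⟨i - 1, by omega⟩
      exact hP j
  | succ n ih =>
    obtain ⟨K, X, f, g, hs, hX, hK⟩ := h
    obtain ⟨P, d, ε, hε, h0, hd, hXP, hP⟩ := ih hK
    let P' : ℕ → ModuleCat.{u} R
      | 0 => X
      | i + 1 => P i
    let d' : ∀ i, P' (i + 1) →ₗ[R] P' i
      | 0 => f ∘ₗ ε
      | i + 1 => d i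
    refine ⟨P', d', g, hs.surj, ?_, ?_, ?_, ?_⟩
    · intro x
      refine (hs.exact x).trans ⟨?_, ?_⟩
      · rintro ⟨y, rfl⟩
        obtain ⟨z, rfl⟩ := hε y
        exact ⟨z, rfl⟩
      · rintro ⟨z, rfl⟩
        exact ⟨ε z, rfl⟩
    · rintro (_ | i)
      · intro x
        exact (map_eq_zero_iff f hs.inj).trans (h0 x)
      · exact hd i
    · rintro (_ | i) hi
      · exact hX
      · exact hXP i (by omega)
    · rintro (_ | i) hi
      · omega
      · exact hP i (by omega)

lemma hasResOfLength_iff {𝒳 : ModuleCat.{u} R → Prop} (h𝒳 : IsoInvariant 𝒳) {n : ℕ}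
    {M : ModuleCat.{u} R} : HasResOfLength R 𝒳 n M ↔ HasRes 𝒳 n M :=
  ⟨HasResOfLength.hasRes h𝒳, HasRes.hasResOfLength⟩

end Resolutions

section FlatCotorsion

variable {R : Type u} [CommRing R]

lemma IsSES.exists_pushout {A B D L G : Type u} [AddCommGroup A] [AddCommGroup B]
    [AddCommGroup D] [AddCommGroup L] [AddCommGroup G] [Module R A] [Module R B] [Module R D]
    [Module R L] [Module R G] {f : A →ₗ[R] B} {g : B →ₗ[R] D} {h : A →ₗ[R] L} {k : L →ₗ[R] G}
    (hs : IsSES f g) (ht : IsSES h k) :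
    ∃ (P : ModuleCat.{u} R) (i : B →ₗ[R] P) (j : L →ₗ[R] P) (p : P →ₗ[R] D) (q : P →ₗ[R] G),
      IsSES j p ∧ IsSES i q := by
  let N : Submodule R (B × L) := LinearMap.range (f.prod (-h))
  have hN (x : B × L) : N.mkQ x = 0 ↔ ∃ a, f a = x.1 ∧ -h a = x.2 := by
    rw [Submodule.mkQ_apply, Submodule.Quotient.mk_eq_zero, LinearMap.mem_range]
    simp [Prod.ext_iff]
  have hrel (a : A) : N.mkQ (f a, 0) = N.mkQ (0, h a) := by
    rw [← sub_eq_zero, ← map_sub, hN]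
    exact ⟨a, by simp, by simp⟩
  have hp : N ≤ LinearMap.ker (g ∘ₗ LinearMap.fst R B L) := by
    rintro _ ⟨a, rfl⟩
    exact hs.exact.apply_apply_eq_zero a
  have hq : N ≤ LinearMap.ker (k ∘ₗ LinearMap.snd R B L) := by
    rintro _ ⟨a, rfl⟩
    change k (-h a) = 0
    rw [map_neg, ht.exact.apply_apply_eq_zero, neg_zero]
  have hadd (b : B) (l : L) : N.mkQ (b, l) = N.mkQ (b, 0) + N.mkQ (0, l) := by
    rw [← map_add]
    simp
  refine ⟨ModuleCat.of R ((B × L) ⧸ N), N.mkQ ∘ₗ LinearMap.inl R B L,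
    N.mkQ ∘ₗ LinearMap.inr R B L, N.liftQ _ hp, N.liftQ _ hq, ⟨?_, ?_, ?_⟩, ⟨?_, ?_, ?_⟩⟩
  · refine (injective_iff_map_eq_zero _).2 fun l hl => ?_
    obtain ⟨a, ha, rfl⟩ := (hN (0, l)).1 hl
    have ha0 : a = 0 := hs.inj (ha.trans (map_zero f).symm)
    simp [ha0]
  · intro x
    obtain ⟨⟨b, l⟩, rfl⟩ := N.mkQ_surjective x
    refine (hs.exact b).trans ⟨?_, ?_⟩
    · rintro ⟨a, rfl⟩
      refine ⟨h a + l, ?_⟩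
      rw [hadd, hrel, ← map_add]
      simp
    · rintro ⟨l', hl'⟩
      refine (hs.exact b).1 ?_
      exact (congrArg (N.liftQ _ hp) hl').symm.trans (map_zero g)
  · intro d
    obtain ⟨b, rfl⟩ := hs.surj d
    exact ⟨N.mkQ (b, 0), rfl⟩
  · refine (injective_iff_map_eq_zero _).2 fun b hb => ?_
    obtain ⟨a, rfl, ha⟩ := (hN (b, 0)).1 hb
    have ha0 : a = 0 := ht.inj ((neg_eq_zero.1 ha).trans (map_zero h).symm)
    simp [ha0]
  · intro x
    obtain ⟨⟨b, l⟩, rfl⟩ := N.mkQ_surjective x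
    refine (ht.exact l).trans ⟨?_, ?_⟩
    · rintro ⟨a, rfl⟩
      refine ⟨b + f a, ?_⟩
      rw [hadd, ← hrel, ← map_add]
      simp
    · rintro ⟨b', hb'⟩
      refine (ht.exact l).1 ?_
      exact (congrArg (N.liftQ _ hq) hb').symm.trans (map_zero k)
  · intro d
    obtain ⟨l, rfl⟩ := ht.surj d
    exact ⟨N.mkQ (0, l), rfl⟩

lemma IsSES.exists_coker_comp {A B D E W : Type u} [AddCommGroup A] [AddCommGroup B]
    [AddCommGroup D] [AddCommGroup E] [AddCommGroup W] [Module R A] [Module R B] [Module R D]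
    [Module R E] [Module R W] {j : A →ₗ[R] B} {p : B →ₗ[R] D} {w : B →ₗ[R] E} {s : E →ₗ[R] W}
    (h : IsSES j p) (h' : IsSES w s) :
    ∃ (L : ModuleCat.{u} R) (π : E →ₗ[R] L) (f : D →ₗ[R] L) (g : L →ₗ[R] W),
      IsSES (w ∘ₗ j) π ∧ IsSES f g := by
  have hr := isSES_range (f := w ∘ₗ j) (h'.inj.comp h.inj)
  obtain ⟨f, hf⟩ := h.exists_desc ((LinearMap.range (w ∘ₗ j)).mkQ ∘ₗ w) hr.comp_eq_zero
  obtain ⟨g, hg⟩ := hr.exists_desc s (by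
    rw [← LinearMap.comp_assoc, h'.comp_eq_zero, LinearMap.zero_comp])
  refine ⟨ModuleCat.of R (E ⧸ LinearMap.range (w ∘ₗ j)), _, f, g, hr, ?_, ?_, ?_⟩
  · refine (injective_iff_map_eq_zero f).2 fun d hd => ?_
    obtain ⟨b, rfl⟩ := h.surj d
    obtain ⟨a, ha⟩ := (hr.exact (w b)).1 ((LinearMap.congr_fun hf b).symm.trans hd)
    rw [← h'.inj ha]
    exact h.exact.apply_apply_eq_zero a
  · intro x
    obtain ⟨e, rfl⟩ := hr.surj x
    rw [show g _ = s e from LinearMap.congr_fun hg e, h'.exact e]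
    constructor
    · rintro ⟨b, rfl⟩
      exact ⟨p b, LinearMap.congr_fun hf b⟩
    · rintro ⟨d, hd⟩
      obtain ⟨b, rfl⟩ := h.surj d
      rw [← h'.exact e, ← show g _ = s e from LinearMap.congr_fun hg e, ← hd,
        show f (p b) = _ from LinearMap.congr_fun hf b]
      exact (LinearMap.congr_fun hg (w b)).trans (h'.exact.apply_apply_eq_zero b)
  · intro y
    obtain ⟨e, rfl⟩ := h'.surj y
    exact ⟨_, LinearMap.congr_fun hg e⟩

/-- The class of flat cotorsion modules. -/
def FlatCotorsion (F : ModuleCat.{u} R) : Prop :=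
  Module.Flat R F ∧ IsCotorsion R F

lemma flatCotorsion_doubleDual [IsNoetherianRing R] (F : ModuleCat.{u} R) [Module.Flat R F] :
    FlatCotorsion (ModuleCat.of R (CharacterModule (CharacterModule F))) :=
  ⟨CharacterModule.flat_doubleDual, (isCotorsion_iff _).2 .characterModule⟩

/-- A module of finite flat dimension embeds, with flat cokernel, into a module with a
flat cotorsion resolution of the same length. -/
lemma HasRes.exists_embedding [IsNoetherianRing R] {n : ℕ} {K : ModuleCat.{u} R}
    (h : HasRes (fun F : ModuleCat.{u} R => Module.Flat R F) n K) :
    ∃ (L G : ModuleCat.{u} R) (f : K →ₗ[R] L) (g : L →ₗ[R] G),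
      IsSES f g ∧ Module.Flat R G ∧ HasRes FlatCotorsion n L := by
  induction n generalizing K with
  | zero =>
    have : Module.Flat R K := h
    exact ⟨_, ModuleCat.of R _, _, _, isSES_range CharacterModule.toDoubleDual_injective,
      CharacterModule.flat_coker_toDoubleDual, flatCotorsion_doubleDual K⟩
  | succ n ih =>
    obtain ⟨K', X, f, g, hs, hX, hK'⟩ := h
    have : Module.Flat R X := hX
    obtain ⟨L', G', f', g', hs', hG', hL'⟩ := ih hK'
    obtain ⟨P, i, j, p, q, hjp, hiq⟩ := hs.exists_pushout hs'
    have : Module.Flat R P := hiq.flat_middle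
    obtain ⟨L, π, u, v, hL, huv⟩ := hjp.exists_coker_comp
      (isSES_range (CharacterModule.toDoubleDual_injective (R := R) (A := P)))
    exact ⟨L, ModuleCat.of R _, u, v, huv, CharacterModule.flat_coker_toDoubleDual,
      L', _, _, π, hL, flatCotorsion_doubleDual P, hL'⟩

lemma HasRes.isCotorsion {n : ℕ} {K : ModuleCat.{u} R} (h : HasRes FlatCotorsion n K) :
    IsCotorsionModule R K := by
  induction n generalizing K with
  | zero => exact (isCotorsion_iff K).1 h.2
  | succ n ih =>
    obtain ⟨K', X, f, g, hs, hX, hK'⟩ := h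
    exact .of_coker hs (ih hK') ((isCotorsion_iff X).1 hX.2)

lemma HasRes.flatCotorsion [IsNoetherianRing R] {n : ℕ} {K : ModuleCat.{u} R}
    (h : HasRes (fun F : ModuleCat.{u} R => Module.Flat R F) n K) (hK : IsCotorsionModule R K) :
    HasRes FlatCotorsion n K := by
  cases n with
  | zero => exact ⟨h, (isCotorsion_iff K).2 hK⟩
  | succ n =>
    obtain ⟨K', X, f, g, hs, hX, hK'⟩ := h
    have : Module.Flat R X := hX
    obtain ⟨L', G', f', g', hs', hG', hL'⟩ := hK'.exists_embedding
    obtain ⟨P, i, j, p, q, hjp, hiq⟩ := hs.exists_pushout hs'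
    exact ⟨L', P, j, p, hjp, ⟨hiq.flat_middle,
      (isCotorsion_iff P).2 (.of_middle hjp hL'.isCotorsion hK)⟩, hL'⟩

end FlatCotorsion

section FoxbyEquivalence

variable {R : Type u} [CommRing R]

/-- The class of modules of the form `F ⊗ C` with `F` in a given class. -/
def TensorClass (C : ModuleCat.{u} R) (𝒴 : ModuleCat.{u} R → Prop) (M : ModuleCat.{u} R) : Prop :=
  ∃ F : ModuleCat.{u} R, 𝒴 F ∧ Nonempty (M ≃ₗ[R] (F ⊗[R] C))

lemma isCFlatCotorsion_eq (C : ModuleCat.{u} R) :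
    IsCFlatCotorsion R C = TensorClass C FlatCotorsion := by
  ext M
  simp only [IsCFlatCotorsion, TensorClass, FlatCotorsion, and_assoc]

lemma isoInvariant_tensorClass (C : ModuleCat.{u} R) (𝒴 : ModuleCat.{u} R → Prop) :
    IsoInvariant (TensorClass C 𝒴) :=
  fun _ _ ⟨e⟩ ⟨F, hF, ⟨e'⟩⟩ => ⟨F, hF, ⟨e.symm ≪≫ₗ e'⟩⟩

lemma isoInvariant_flat : IsoInvariant (fun F : ModuleCat.{u} R => Module.Flat R F) :=
  fun _ _ ⟨e⟩ (_ : Module.Flat R _) => .of_linearEquiv e.symm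

lemma isoInvariant_flatCotorsion : IsoInvariant (FlatCotorsion (R := R)) :=
  fun A B ⟨e⟩ hA => ⟨isoInvariant_flat A B ⟨e⟩ hA.1,
    (isCotorsion_iff B).2 (((isCotorsion_iff A).1 hA.2).of_equiv e)⟩

variable [IsNoetherianRing R] {C : ModuleCat.{u} R} [Module.Finite R C]
  {𝒴 : ModuleCat.{u} R → Prop} {n : ℕ}

lemma TensorClass.isBass_and_hom (hC : Function.Bijective (LinearMap.lsmul R C))
    (hCC : ExtVanish R C C) (h𝒴 : IsoInvariant 𝒴) (hflat : ∀ F, 𝒴 F → Module.Flat R F)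
    {M : ModuleCat.{u} R} (h : TensorClass C 𝒴 M) :
    IsBass R C M ∧ 𝒴 (ModuleCat.of R (C →ₗ[R] M)) := by
  obtain ⟨F, hF, ⟨e⟩⟩ := h
  have := hflat F hF
  have hA : IsAuslander R C F := .of_flat hC hCC
  exact ⟨hA.isBass.of_equiv e.symm,
    h𝒴 F _ ⟨LinearEquiv.ofBijective _ hA.2 ≪≫ₗ e.symm.congrRight⟩ hF⟩

lemma HasRes.isBass_and_hom (hC : Function.Bijective (LinearMap.lsmul R C))
    (hCC : ExtVanish R C C) (h𝒴 : IsoInvariant 𝒴) (hflat : ∀ F, 𝒴 F → Module.Flat R F)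
    {M : ModuleCat.{u} R} (h : HasRes (TensorClass C 𝒴) n M) :
    IsBass R C M ∧ HasRes 𝒴 n (ModuleCat.of R (C →ₗ[R] M)) := by
  induction n generalizing M with
  | zero => exact TensorClass.isBass_and_hom hC hCC h𝒴 hflat h
  | succ n ih =>
    obtain ⟨K, X, f, g, hs, hX, hK⟩ := h
    obtain ⟨hKB, hKres⟩ := ih hK
    obtain ⟨hXB, hX𝒴⟩ := hX.isBass_and_hom hC hCC h𝒴 hflat
    exact ⟨.of_ses hs hKB hXB, ModuleCat.of R (C →ₗ[R] K), ModuleCat.of R (C →ₗ[R] X), _, _,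
      hs.compRight hKB.1, hX𝒴, hKres⟩

lemma HasRes.isAuslander_and_tensor (hC : Function.Bijective (LinearMap.lsmul R C))
    (hCC : ExtVanish R C C) (hflat : ∀ F, 𝒴 F → Module.Flat R F)
    {K : ModuleCat.{u} R} (h : HasRes 𝒴 n K) :
    IsAuslander R C K ∧ HasRes (TensorClass C 𝒴) n (ModuleCat.of R (K ⊗[R] C)) := by
  induction n generalizing K with
  | zero =>
    have := hflat K h
    exact ⟨.of_flat hC hCC, K, h, ⟨.refl R _⟩⟩
  | succ n ih =>
    obtain ⟨K', X, f, g, hs, hX, hK⟩ := h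
    obtain ⟨hKA, hKres⟩ := ih hK
    have := hflat X hX
    have hXA : IsAuslander R C X := .of_flat hC hCC
    exact ⟨.of_ses hC.1 hs hKA hXA, ModuleCat.of R (K' ⊗[R] C), ModuleCat.of R (X ⊗[R] C), _, _,
      hKA.isSES_rTensor hC.1 hs hXA, ⟨X, hX, ⟨.refl R _⟩⟩, hKres⟩

end FoxbyEquivalence

/-- Characterizations of modules of `C`-flat `C`-cotorsion projective
dimension at most `n`. -/
theorem stmt16 (R : Type u) [CommRing R] [IsNoetherianRing R]
    (C : ModuleCat.{u} R) (hC : IsSemidualizing R C) (M : ModuleCat.{u} R) (n : ℕ) :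
    (HasResOfLength R (IsCFlatCotorsion R C) n M ↔
      ∃ K : ModuleCat.{u} R,
        HasResOfLength R (fun F => Module.Flat R ↥F ∧ IsCotorsion R F) n K ∧
        Nonempty (↥M ≃ₗ[R] (↥C ⊗[R] ↥K))) ∧
    (HasResOfLength R (IsCFlatCotorsion R C) n M ↔
      (HasResOfLength R (IsCFlat R C) n M ∧
       ∀ N : ModuleCat.{u} R, IsCFlat R C N → extZero R N M)) := by
  obtain ⟨hfin, hhom, hCC⟩ := hC
  rw [extZero_iff] at hCC
  have hflat : ∀ F : ModuleCat.{u} R, FlatCotorsion F → Module.Flat R F := fun F hF => hF.1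
  have h12 (h : HasResOfLength R (IsCFlatCotorsion R C) n M) : IsBass R C M ∧
      HasRes FlatCotorsion n (ModuleCat.of R (C →ₗ[R] M)) := by
    rw [isCFlatCotorsion_eq, hasResOfLength_iff (isoInvariant_tensorClass C _)] at h
    exact h.isBass_and_hom hhom hCC isoInvariant_flatCotorsion hflat
  have h21 (K : ModuleCat.{u} R) (hK : HasRes FlatCotorsion n K) (e : (K ⊗[R] C) ≃ₗ[R] M) :
      HasResOfLength R (IsCFlatCotorsion R C) n M := by
    rw [isCFlatCotorsion_eq, hasResOfLength_iff (isoInvariant_tensorClass C _)]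
    exact (hK.isAuslander_and_tensor hhom hCC hflat).2.of_equiv (isoInvariant_tensorClass C _) e
  refine ⟨⟨fun h => ?_, ?_⟩, fun h => ⟨?_, ?_⟩, ?_⟩
  · obtain ⟨hM, hres⟩ := h12 h
    exact ⟨ModuleCat.of R (C →ₗ[R] M), hres.hasResOfLength,
      ⟨(LinearEquiv.ofBijective _ hM.2).symm ≪≫ₗ TensorProduct.comm R _ _⟩⟩
  · rintro ⟨K, hK, ⟨e⟩⟩
    exact h21 K (hK.hasRes isoInvariant_flatCotorsion) (TensorProduct.comm R _ _ ≪≫ₗ e.symm)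
  · obtain ⟨P, d, ε, hε, h0, hd, hX, hP⟩ := h
    refine ⟨P, d, ε, hε, h0, hd, fun i hi => ?_, hP⟩
    obtain ⟨F, hF, -, e⟩ := hX i hi
    exact ⟨F, hF, e⟩
  · rintro N ⟨F, hF, ⟨e⟩⟩
    obtain ⟨hM, hres⟩ := h12 h
    rw [extZero_iff]
    exact (ExtVanish.tensor_left_of_flat hM.1 hres.isCotorsion).of_equiv_left e.symm
  · rintro ⟨hres, hext⟩
    obtain ⟨hM, hK⟩ := (hres.hasRes (isoInvariant_tensorClass C _)).isBass_and_hom hhom hCC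
      isoInvariant_flat fun F hF => hF
    have hcot : IsCotorsionModule R (C →ₗ[R] M) := .hom_of_tensor fun F _ _ hF =>
      (extZero_iff (ModuleCat.of R (F ⊗[R] C)) M).1
        (hext _ ⟨ModuleCat.of R F, hF, ⟨.refl R _⟩⟩)
    exact h21 _ (hK.flatCotorsion hcot) (LinearEquiv.ofBijective _ hM.2)
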